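/- Abe–Terao–Yoshinaga theorem: let A be a central essential arrangement in K^ℓ such that the multiarrangement (A,m) is free for every choice of multiplicities m : A → ℤ_{≥1}. Then A is, after a linear change of coordinates, a product of arrangements of rank at most 2: there is a direct sum decomposition K^ℓ = V_1 ⊕ ⋯ ⊕ V_s with dim V_j ≤ 2 such that every hyperplane of A has the form V_1 ⊕ ⋯ ⊕ V_{j−1} ⊕ H_j ⊕ V_{j+1} ⊕ ⋯ ⊕ V_s for some j and some hyperplane H_j ⊂ V_j. -/

import Mathlib

open MvPolynomial

namespace Arr

variable (K : Type) [Field K]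

/-- The linear polynomial with coefficient vector `a`. -/
noncomputable def linForm {ℓ : ℕ} (a : Fin ℓ → K) : MvPolynomial (Fin ℓ) K :=
  ∑ j, MvPolynomial.C (a j) * MvPolynomial.X j

/-- A central arrangement: the defining linear forms are nonzero and pairwise
non-proportional. -/
def IsCentral {ι : Type*} {ℓ : ℕ} (A : ι → Fin ℓ → K) : Prop :=
  (∀ i, A i ≠ 0) ∧ ∀ i j, i ≠ j → ∀ c : K, A i ≠ c • A j

/-- The derivation module `D(A,m)` of a multiarrangement: those `K`-derivations `θ` of
`S = K[x_1,…,x_ℓ]` with `θ(l_i) ∈ ⟨l_i^{m_i}⟩` for every `i`. -/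
noncomputable def derivModuleMulti {ι : Type*} {ℓ : ℕ} (A : ι → Fin ℓ → K) (m : ι → ℕ) :
    Submodule (MvPolynomial (Fin ℓ) K)
      (Derivation K (MvPolynomial (Fin ℓ) K) (MvPolynomial (Fin ℓ) K)) where
  carrier := {θ | ∀ i, θ (linForm K (A i)) ∈ Ideal.span {linForm K (A i) ^ m i}}
  add_mem' := by
    intro θ η hθ hη i
    rw [Derivation.add_apply]
    exact add_mem (hθ i) (hη i)
  zero_mem' := by intro i; simp
  smul_mem' := by
    intro f θ h i
    rw [Derivation.smul_apply]
    exact Ideal.mul_mem_left _ f (h i)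


/-- The linear functional with coefficient vector `a`. -/
noncomputable def linFunc {ℓ : ℕ} (a : Fin ℓ → K) : (Fin ℓ → K) →ₗ[K] K :=
  ∑ j, a j • LinearMap.proj j

/-- The hyperplane `ker (a ⬝ x)`. -/
noncomputable def hyperplane {ℓ : ℕ} (a : Fin ℓ → K) : Submodule K (Fin ℓ → K) :=
  LinearMap.ker (linFunc K a)

/-- An essential arrangement: the defining forms span the space of linear forms. -/
def IsEssential {ι : Type*} {ℓ : ℕ} (A : ι → Fin ℓ → K) : Prop :=
  Submodule.span K (Set.range A) = ⊤

end Arr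

open Arr

namespace Arr

section Graded

variable {σ k : Type*}

theorem homogeneousComponent_mul_of_isHomogeneous [CommSemiring k] {p : MvPolynomial σ k} {e : ℕ}
    (hp : p.IsHomogeneous e) (q : MvPolynomial σ k) (d : ℕ) :
    homogeneousComponent d (p * q) =
      if e ≤ d then p * homogeneousComponent (d - e) q else 0 := by
  classical
  let := gradedAlgebra (σ := σ) (R := k)
  have hp' : p ∈ homogeneousSubmodule σ k e := hp
  have key (r : MvPolynomial σ k) (n : ℕ) : homogeneousComponent n r =
      ((DirectSum.decompose (homogeneousSubmodule σ k) r) n : MvPolynomial σ k) :=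
    (decomposition.decompose'_apply r n).symm
  split_ifs with h
  · rw [key, key, DirectSum.coe_decompose_mul_of_left_mem_of_le _ hp' h]
  · rw [key, DirectSum.coe_decompose_mul_of_left_mem_of_not_le _ hp' h]

theorem dvd_homogeneousComponent [CommSemiring k] {p q : MvPolynomial σ k} {e : ℕ}
    (hp : p.IsHomogeneous e) (h : p ∣ q) (d : ℕ) : p ∣ homogeneousComponent d q := by
  obtain ⟨r, rfl⟩ := h
  rw [homogeneousComponent_mul_of_isHomogeneous hp]
  split_ifs
  · exact dvd_mul_right _ _
  · exact dvd_zero _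

theorem eq_zero_of_dvd_of_isHomogeneous [CommSemiring k] [NoZeroDivisors k]
    {p q : MvPolynomial σ k} {a b : ℕ}
    (hp : p.IsHomogeneous a) (hq : q.IsHomogeneous b) (hdvd : p ∣ q) (hlt : b < a) : q = 0 := by
  by_contra h0
  obtain ⟨r, rfl⟩ := hdvd
  have hp0 : p ≠ 0 := left_ne_zero_of_mul h0
  have h1 := totalDegree_mul_of_isDomain hp0 (right_ne_zero_of_mul h0)
  rw [hq.totalDegree h0, hp.totalDegree hp0] at h1
  omega

theorem isHomogeneous_det [CommRing k] {ι : Type*} [Fintype ι] [DecidableEq ι]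
    {M : Matrix ι ι (MvPolynomial σ k)} {d : ι → ℕ} (h : ∀ i j, (M i j).IsHomogeneous (d i)) :
    M.det.IsHomogeneous (∑ i, d i) := by
  rw [Matrix.det_apply]
  refine IsHomogeneous.sum _ _ _ fun τ _ => ?_
  rw [Units.smul_def, ← Int.cast_smul_eq_zsmul k, smul_eq_C_mul]
  refine IsHomogeneous.C_mul ?_ _
  rw [← Equiv.sum_comp τ d]
  exact IsHomogeneous.prod _ _ _ fun i _ => h _ _

variable [Field k] {ι : Type*} [Fintype ι]

theorem exists_det_homogeneousComponent_ne_zero [DecidableEq ι]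
    {M : Matrix ι ι (MvPolynomial σ k)} (hM : M.det ≠ 0) :
    ∃ d : ι → ℕ, ∑ i, d i ≤ M.det.totalDegree ∧
      (Matrix.of fun i j => homogeneousComponent (d i) (M i j)).det ≠ 0 := by
  by_contra! hcon
  obtain ⟨N, hN⟩ : ∃ N, ∀ i j, (M i j).totalDegree < N := by
    refine ⟨(Finset.univ.sup fun i => Finset.univ.sup fun j => (M i j).totalDegree) + 1,
      fun i j => Nat.lt_succ_of_le ?_⟩
    exact (Finset.le_sup (f := fun j => (M i j).totalDegree) (Finset.mem_univ j)).trans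
      (Finset.le_sup (f := fun i => Finset.univ.sup fun j => (M i j).totalDegree)
        (Finset.mem_univ i))
  have hrow (i : ι) : M i = ∑ d ∈ Finset.range N,
      fun j => homogeneousComponent d (M i j) := by
    funext j
    rw [Finset.sum_apply]
    conv_lhs => rw [← sum_homogeneousComponent (M i j)]
    refine Finset.sum_subset (by simpa using hN i j) fun d _ hd => ?_
    exact homogeneousComponent_eq_zero _ _ (by simpa using hd)
  have hexp : M.det = ∑ d ∈ Fintype.piFinset fun _ : ι => Finset.range N,
      (Matrix.of fun i j => homogeneousComponent (d i) (M i j)).det := by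
    have h1 := (Matrix.detRowAlternating (n := ι)
      (R := MvPolynomial σ k)).toMultilinearMap.map_sum_finset
        (fun i d j => homogeneousComponent d (M i j)) (fun _ => Finset.range N)
    rw [← funext hrow] at h1
    exact h1
  refine hM ?_
  rw [← sum_homogeneousComponent M.det]
  refine Finset.sum_eq_zero fun o ho => ?_
  rw [hexp, map_sum]
  refine Finset.sum_eq_zero fun d _ => ?_
  rw [homogeneousComponent_of_mem (n := ∑ i, d i)
    (isHomogeneous_det (M := Matrix.of fun i j => homogeneousComponent (d i) (M i j))
      fun i j => homogeneousComponent_isHomogeneous _ _)]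
  split_ifs with h
  · exact hcon d (by rw [← h]; exact Nat.lt_succ_iff.mp (Finset.mem_range.mp ho))
  · rfl

theorem linearIndependent_of_det_ne_zero {R : Type*} [CommRing R] [IsDomain R] [DecidableEq ι]
    {v : ι → ι → R} (h : (Matrix.of v).det ≠ 0) : LinearIndependent R v := by
  rw [Fintype.linearIndependent_iff]
  intro g hg
  by_contra! hne
  refine h (Matrix.exists_vecMul_eq_zero_iff.mp ⟨g, fun h0 => ?_, ?_⟩)
  · obtain ⟨i, hi⟩ := hne
    exact hi (congrFun h0 i)
  · rw [Matrix.vecMul_eq_sum]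
    exact hg

theorem det_ne_zero_of_linearIndependent {R : Type*} [CommRing R] [IsDomain R] [DecidableEq ι]
    {v : ι → ι → R} (h : LinearIndependent R v) : (Matrix.of v).det ≠ 0 := by
  intro h0
  obtain ⟨g, hg, hgv⟩ := Matrix.exists_vecMul_eq_zero_iff.mpr h0
  rw [Matrix.vecMul_eq_sum] at hgv
  exact hg (funext (Fintype.linearIndependent_iff.mp h g hgv))

/-- A free submodule of full rank of `Sⁿ` which is closed under taking homogeneous components
has a basis of homogeneous vectors. -/
theorem exists_homogeneous_basis [Finite σ]
    (D : Submodule (MvPolynomial σ k) (ι → MvPolynomial σ k))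
    [Module.Free (MvPolynomial σ k) D]
    (hfull : ∃ q : MvPolynomial σ k, q ≠ 0 ∧ ∀ v, q • v ∈ D)
    (hcomp : ∀ v ∈ D, ∀ d, (fun j => homogeneousComponent d (v j)) ∈ D) :
    ∃ (ξ : ι → ι → MvPolynomial σ k) (d : ι → ℕ), (∀ i, ξ i ∈ D) ∧
      (∀ i j, (ξ i j).IsHomogeneous (d i)) ∧ LinearIndependent (MvPolynomial σ k) ξ ∧
      D ≤ Submodule.span (MvPolynomial σ k) (Set.range ξ) := by
  classical
  have hrank : Module.finrank (MvPolynomial σ k) D = Fintype.card ι := by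
    refine le_antisymm ((Submodule.finrank_le D).trans_eq (by simp)) ?_
    obtain ⟨q, hq, hqD⟩ := hfull
    have hli : LinearIndependent (MvPolynomial σ k)
        fun i : ι => (⟨_, hqD (Pi.single i 1)⟩ : D) := by
      refine LinearIndependent.of_comp D.subtype ?_
      rw [Fintype.linearIndependent_iff]
      intro g hg i
      have := congrFun hg i
      simpa [Finset.sum_apply, Pi.single_apply, hq] using this
    exact hli.fintype_card_le_finrank
  let θ := (Module.finBasisOfFinrankEq (MvPolynomial σ k) D hrank).reindex
    (Fintype.equivFin ι).symm
  let Θ : Matrix ι ι (MvPolynomial σ k) := Matrix.of fun i => (θ i : ι → MvPolynomial σ k)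
  have hΘ : Θ.det ≠ 0 := det_ne_zero_of_linearIndependent
    (θ.linearIndependent.map' D.subtype (Submodule.ker_subtype D))
  obtain ⟨d, hd, hdet⟩ := exists_det_homogeneousComponent_ne_zero hΘ
  let ξ : ι → ι → MvPolynomial σ k := fun i j => homogeneousComponent (d i) (Θ i j)
  have hξD (i : ι) : ξ i ∈ D := hcomp _ (θ i).2 _
  have hξh (i j : ι) : (ξ i j).IsHomogeneous (d i) := homogeneousComponent_isHomogeneous _ _
  let T : Matrix ι ι (MvPolynomial σ k) := Matrix.of fun i j => θ.repr ⟨ξ i, hξD i⟩ j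
  have hT : Matrix.of ξ = T * Θ := by
    ext1 i j
    have h1 := congrArg Subtype.val (θ.sum_repr ⟨ξ i, hξD i⟩)
    have h2 := congrFun h1 j
    simp only [Submodule.coe_sum, Finset.sum_apply] at h2
    rw [Matrix.mul_apply]
    exact h2.symm
  have hTdet : IsUnit T.det := by
    have h1 : (Matrix.of ξ).det = T.det * Θ.det := by rw [hT, Matrix.det_mul]
    have h2 : T.det ≠ 0 := fun h => hdet (by rw [h, zero_mul] at h1; exact h1)
    have h3 := totalDegree_mul_of_isDomain h2 hΘ
    rw [← h1, (isHomogeneous_det (M := Matrix.of ξ) hξh).totalDegree hdet] at h3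
    have h4 : T.det.totalDegree = 0 := by omega
    rw [totalDegree_eq_zero_iff_eq_C] at h4
    rw [h4] at h2 ⊢
    refine (IsUnit.mk0 _ fun h => h2 ?_).map C
    rw [h, map_zero]
  refine ⟨ξ, d, hξD, hξh, linearIndependent_of_det_ne_zero hdet, fun v hv => ?_⟩
  have hΘξ : Θ = T⁻¹ * Matrix.of ξ := by
    rw [hT, ← Matrix.mul_assoc, Matrix.nonsing_inv_mul _ hTdet, Matrix.one_mul]
  have h1 := congrArg Subtype.val (θ.sum_repr ⟨v, hv⟩)
  simp only [Submodule.coe_sum, Submodule.coe_smul] at h1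
  rw [← h1]
  refine Submodule.sum_mem _ fun i _ => Submodule.smul_mem _ _ ?_
  have h2 : (θ i : ι → MvPolynomial σ k) = ∑ j, T⁻¹ i j • ξ j := by
    have h3 : (θ i : ι → MvPolynomial σ k) = Θ i := rfl
    rw [h3, hΘξ]
    funext j
    simp [Matrix.mul_apply, Finset.sum_apply]
  rw [h2]
  exact Submodule.sum_mem _ fun j _ => Submodule.smul_mem _ _
    (Submodule.subset_span (Set.mem_range_self j))

/-- A homogeneous vector in the span of homogeneous vectors is a combination of those whose
degree does not exceed its own. -/
theorem exists_eq_sum_of_degree_le {ξ : ι → ι → MvPolynomial σ k} {d : ι → ℕ}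
    (hξ : ∀ i j, (ξ i j).IsHomogeneous (d i)) {v : ι → MvPolynomial σ k} {e : ℕ}
    (hv : ∀ j, (v j).IsHomogeneous e)
    (hspan : v ∈ Submodule.span (MvPolynomial σ k) (Set.range ξ)) :
    ∃ c : ι → MvPolynomial σ k, (∀ i, e < d i → c i = 0) ∧ v = ∑ i, c i • ξ i := by
  obtain ⟨c, hc⟩ := (Submodule.mem_span_range_iff_exists_fun _).mp hspan
  refine ⟨fun i => if d i ≤ e then homogeneousComponent (e - d i) (c i) else 0,
    fun i hi => if_neg hi.not_ge, ?_⟩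
  funext j
  have h1 := congrArg (homogeneousComponent e) (congrFun hc j)
  rw [homogeneousComponent_eq_self (hv j)] at h1
  rw [← h1]
  simp only [Finset.sum_apply, Pi.smul_apply, smul_eq_mul, map_sum]
  refine Finset.sum_congr rfl fun i _ => ?_
  rw [mul_comm, homogeneousComponent_mul_of_isHomogeneous (hξ i j), ite_mul, zero_mul, mul_comm]

end Graded

section Multi

variable {τ k ι κ : Type*} [Field k] [Fintype ι] [Fintype κ]

theorem sum_eq_add_of_eq_zero {R : Type*} [CommSemiring R] {y z : κ} (hyz : y ≠ z) (a : κ → R)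
    {w : κ → R} (hw : ∀ j, j ≠ y → j ≠ z → w j = 0) :
    ∑ j, a j * w j = a y * w y + a z * w z :=
  Fintype.sum_eq_add y z hyz fun j hj => by rw [hw j hj.1 hj.2, mul_zero]

open Classical in
/-- Suppose that the vectors `w` satisfying `L i ^ m i ∣ ∑ j, c i j * w j` form a free module,
where the multiplicities of all coordinate forms but those of `y` and `z` are large, and the
multiplicity of `y` is larger than those of the forms involving `z`. Then some `w` in the
module is supported on the coordinates `y` and `z` and its `y`-coordinate divides the product
of the powers `L i ^ m i` whose forms involve `y` but not `z`. -/
theorem exists_dvd_prod_of_free [Finite τ] [DecidableEq κ]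
    (L : ι → MvPolynomial τ k) (c : ι → κ → k) (m : ι → ℕ)
    (D : Submodule (MvPolynomial τ k) (κ → MvPolynomial τ k)) [Module.Free (MvPolynomial τ k) D]
    (hD : ∀ w, w ∈ D ↔ ∀ i, L i ^ m i ∣ ∑ j, C (c i j) * w j)
    (hhom : ∀ i, (L i).IsHomogeneous 1) (hirr : ∀ i, Irreducible (L i))
    (hrel : ∀ i i', i ≠ i' → IsRelPrime (L i) (L i'))
    (s : κ → ι) (hs : ∀ j, c (s j) = Pi.single j 1) {y z : κ} (hyz : y ≠ z)
    (hy : ∑ i with c i z ≠ 0, m i < m (s y))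
    (hx : ∀ j, j ≠ y → j ≠ z →
      ∑ i with c i z = 0 ∧ c i y ≠ 0, m i + ∑ i with c i z ≠ 0, m i < m (s j)) :
    ∃ w ∈ D, (∀ j, j ≠ y → j ≠ z → w j = 0) ∧
      w y ∣ ∏ i with c i z = 0 ∧ c i y ≠ 0, L i ^ m i := by
  have hpow (i : ι) : (L i ^ m i).IsHomogeneous (m i) := by simpa using (hhom i).pow (m i)
  have hL0 (i : ι) : L i ^ m i ≠ 0 := pow_ne_zero _ (hirr i).ne_zero
  have hrelpow (i i' : ι) (h : i ≠ i') : IsRelPrime (L i ^ m i) (L i' ^ m i') :=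
    ((hrel i i' h).pow_left).pow_right
  set E := ∏ i with c i z = 0 ∧ c i y ≠ 0, L i ^ m i with hE
  set P := ∏ i with c i z ≠ 0, L i ^ m i with hP
  set dE := ∑ i with c i z = 0 ∧ c i y ≠ 0, m i
  set dP := ∑ i with c i z ≠ 0, m i
  have hEhom : E.IsHomogeneous dE := IsHomogeneous.prod _ _ _ fun i _ => hpow i
  have hPhom : P.IsHomogeneous dP := IsHomogeneous.prod _ _ _ fun i _ => hpow i
  have hE0 : E ≠ 0 := Finset.prod_ne_zero_iff.mpr fun i _ => hL0 i
  have hP0 : P ≠ 0 := Finset.prod_ne_zero_iff.mpr fun i _ => hL0 i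
  obtain ⟨ξ, d, hξD, hξhom, hξli, hξspan⟩ := exists_homogeneous_basis D
    ⟨∏ i, L i ^ m i, Finset.prod_ne_zero_iff.mpr fun i _ => hL0 i, fun v => (hD _).mpr fun i => by
      simp only [Pi.smul_apply, smul_eq_mul, mul_left_comm (C _), ← Finset.mul_sum]
      exact (Finset.dvd_prod_of_mem _ (Finset.mem_univ i)).mul_right _⟩
    (fun v hv e => (hD _).mpr fun i => by
      simp only [← homogeneousComponent_C_mul, ← map_sum]
      exact dvd_homogeneousComponent (hpow i) ((hD v).mp hv i) e)
  have hcoord {w : κ → MvPolynomial τ k} (hw : w ∈ D) (j : κ) : L (s j) ^ m (s j) ∣ w j := by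
    simpa [hs, Pi.single_apply] using (hD w).mp hw (s j)
  have hlow {i : κ} (hi : d i ≤ dE + dP) (j : κ) (hjy : j ≠ y) (hjz : j ≠ z) : ξ i j = 0 :=
    eq_zero_of_dvd_of_isHomogeneous (hpow _) (hξhom i j) (hcoord (hξD i) j)
      (hi.trans_lt (hx j hjy hjz))
  have hlowest {i : κ} (hi : d i ≤ dP) (j : κ) (hjz : j ≠ z) : ξ i j = 0 := by
    by_cases hjy : j = y
    · subst hjy
      exact eq_zero_of_dvd_of_isHomogeneous (hpow _) (hξhom i j) (hcoord (hξD i) j)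
        (hi.trans_lt hy)
    · exact hlow (hi.trans (Nat.le_add_left _ _)) j hjy hjz
  have hPdvd {w : κ → MvPolynomial τ k} (hw : w ∈ D) (h0 : ∀ j, j ≠ z → w j = 0) : P ∣ w z := by
    refine Finset.prod_dvd_of_isRelPrime (fun i _ i' _ h => hrelpow i i' h) fun i hi => ?_
    have h1 := (hD w).mp hw i
    rw [sum_eq_add_of_eq_zero hyz _ fun j _ hjz => h0 j hjz, h0 y hyz, mul_zero, zero_add] at h1
    have hu : IsUnit (C (c i z) : MvPolynomial τ k) :=
      (IsUnit.mk0 _ (Finset.mem_filter.mp hi).2).map C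
    exact hu.dvd_mul_left.mp h1
  have hPD : Pi.single z P ∈ D := (hD _).mpr fun i => by
    rw [sum_eq_add_of_eq_zero hyz _ fun j _ hjz => Pi.single_eq_of_ne hjz _,
      Pi.single_eq_of_ne hyz, mul_zero, zero_add, Pi.single_eq_same]
    by_cases h : c i z = 0
    · simp [h]
    · exact (Finset.dvd_prod_of_mem (fun i => L i ^ m i) (by simpa using h)).mul_left _
  -- The basis contains a multiple of `P ∂_z`.
  obtain ⟨i₀, u, hu, hi₀⟩ : ∃ i₀, ∃ u : k, u ≠ 0 ∧
      (Pi.single z P : κ → MvPolynomial τ k) = (C u : MvPolynomial τ k) • ξ i₀ := by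
    obtain ⟨a, ha, hsum⟩ := exists_eq_sum_of_degree_le hξhom (v := Pi.single z P) (e := dP)
      (fun j => by
        by_cases h : j = z
        · subst h
          simpa using hPhom
        · simpa [h] using isHomogeneous_zero τ k dP) (hξspan hPD)
    obtain ⟨i, hi⟩ : ∃ i, a i ≠ 0 := by
      by_contra! h
      refine hP0 ?_
      simpa [h] using congrFun hsum z
    have hdi : d i ≤ dP := not_lt.mp fun h => hi (ha i h)
    obtain ⟨r, hr⟩ := hPdvd (hξD i) (hlowest hdi)
    have hξz : ξ i z ≠ 0 := fun h => hξli.ne_zero i <| funext fun j => by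
      by_cases hj : j = z
      · rw [hj, h, Pi.zero_apply]
      · exact hlowest hdi j hj
    have hr0 : r ≠ 0 := fun h => hξz (by rw [hr, h, mul_zero])
    have hdeg := totalDegree_mul_of_isDomain hP0 hr0
    rw [← hr, (hξhom i z).totalDegree hξz, hPhom.totalDegree hP0] at hdeg
    have hrC := totalDegree_eq_zero_iff_eq_C.mp (show r.totalDegree = 0 by omega)
    have hc0 : coeff 0 r ≠ 0 := fun h => hr0 (by rw [hrC, h, map_zero])
    refine ⟨i, (coeff 0 r)⁻¹, inv_ne_zero hc0, funext fun j => ?_⟩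
    by_cases hj : j = z
    · subst hj
      rw [Pi.single_eq_same, Pi.smul_apply, hr, hrC, smul_eq_mul, mul_left_comm, ← C_mul]
      simp [hc0]
    · rw [Pi.single_eq_of_ne hj, Pi.smul_apply, hlowest hdi j hj, smul_zero]
  have hPξ {w : κ → MvPolynomial τ k} (hw : w ∈ D) (h0 : ∀ j, j ≠ z → w j = 0) :
      ∃ r : MvPolynomial τ k, w = r • ξ i₀ := by
    obtain ⟨r, hr⟩ := hPdvd hw h0
    refine ⟨r * C u, ?_⟩
    rw [mul_smul, ← hi₀]
    funext j
    by_cases hj : j = z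
    · subst hj
      rw [Pi.smul_apply, Pi.single_eq_same, hr, smul_eq_mul, mul_comm]
    · rw [h0 j hj, Pi.smul_apply, Pi.single_eq_of_ne hj, smul_zero]
  have hξ₀y : ξ i₀ y = 0 := by
    have h1 := congrFun hi₀ y
    rw [Pi.single_eq_of_ne hyz, Pi.smul_apply, smul_eq_mul, eq_comm, mul_eq_zero] at h1
    exact h1.resolve_left (by simpa using hu)
  have hcoef {i i' : κ} (h : i ≠ i') (h₀ : i ≠ i₀) {a b r : MvPolynomial τ k}
      (h1 : a • ξ i + b • ξ i' + r • ξ i₀ = 0) : a = 0 := by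
    have h2 := Fintype.linearIndependent_iff.mp hξli
      (Pi.single i a + Pi.single i' b + Pi.single i₀ r) (by
        simpa [add_smul, Finset.sum_add_distrib, Pi.single_apply, ite_smul] using h1) i
    simpa [Pi.single_apply, h, h₀] using h2
  have hξy {i : κ} (hi : d i ≤ dE + dP) (hne : i ≠ i₀) : ξ i y ≠ 0 := by
    intro h
    obtain ⟨r, hr⟩ := hPξ (hξD i) fun j hjz => by
      by_cases hjy : j = y
      · rwa [hjy]
      · exact hlow hi j hjy hjz
    exact one_ne_zero (hcoef (a := 1) (b := 0) (r := -r) hne hne (by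
      rw [hr, one_smul, zero_smul, neg_smul, add_zero, add_neg_cancel]))
  have huniq {i i' : κ} (hi : d i ≤ dE + dP) (hne : i ≠ i₀) (hi' : d i' ≤ dE + dP)
      (hne' : i' ≠ i₀) : i = i' := by
    by_contra hii
    obtain ⟨r, hr⟩ := hPξ (w := ξ i' y • ξ i - ξ i y • ξ i')
      (sub_mem (D.smul_mem _ (hξD i)) (D.smul_mem _ (hξD i'))) fun j hjz => by
        by_cases hjy : j = y
        · subst hjy
          simp [mul_comm]
        · simp [hlow hi j hjy hjz, hlow hi' j hjy hjz]
    refine hξy hi' hne' (hcoef (b := -ξ i y) (r := -r) hii hne ?_)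
    rw [neg_smul, neg_smul, ← hr, ← sub_eq_add_neg, ← sub_eq_add_neg, sub_self]
  have hkey (i : ι) (hi : c i z ≠ 0) :
      ∃ a : κ → MvPolynomial τ k, (∀ j, dE + dP < d j → a j = 0) ∧
        E * ∏ i' ∈ ({i' | c i' z ≠ 0} : Finset ι).erase i, L i' ^ m i' = ∑ j, a j * ξ j y := by
    set Q := E * ∏ i' ∈ ({i' | c i' z ≠ 0} : Finset ι).erase i, L i' ^ m i' with hQ
    set e := dE + ∑ i' ∈ ({i' | c i' z ≠ 0} : Finset ι).erase i, m i' with he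
    have hQhom : Q.IsHomogeneous e := hEhom.mul (IsHomogeneous.prod _ _ _ fun i _ => hpow i)
    have hele : e ≤ dE + dP := Nat.add_le_add_left
      (Finset.sum_le_sum_of_subset (Finset.erase_subset _ _)) _
    set w : κ → MvPolynomial τ k := fun j =>
      if j = y then Q else if j = z then C (-(c i y / c i z)) * Q else 0 with hw
    have hwy : w y = Q := if_pos rfl
    have hwz : w z = C (-(c i y / c i z)) * Q := by simp [hw, hyz.symm]
    have hw0 (j : κ) (hjy : j ≠ y) (hjz : j ≠ z) : w j = 0 := by simp [hw, hjy, hjz]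
    have hwD : w ∈ D := (hD w).mpr fun i' => by
      rw [sum_eq_add_of_eq_zero hyz _ hw0, hwy, hwz, show C (c i' y) * Q +
        C (c i' z) * (C (-(c i y / c i z)) * Q) = C (c i' y + c i' z * -(c i y / c i z)) * Q by
          rw [C_add, C_mul]; ring]
      by_cases hii : i' = i
      · subst hii
        rw [show c i' y + c i' z * -(c i' y / c i' z) = 0 by field_simp; ring, C_0, zero_mul]
        exact dvd_zero _
      by_cases hz : c i' z = 0
      · by_cases hy' : c i' y = 0
        · simp [hz, hy']
        · exact ((Finset.dvd_prod_of_mem (fun i => L i ^ m i)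
            (by simp [hz, hy'])).mul_right _).mul_left _
      · exact ((Finset.dvd_prod_of_mem (fun i => L i ^ m i)
          (by simp [hz, hii])).mul_left _).mul_left _
    obtain ⟨a, ha, hsum⟩ := exists_eq_sum_of_degree_le hξhom (v := w) (e := e)
      (fun j => by
        simp only [hw]
        split_ifs
        · exact hQhom
        · exact hQhom.C_mul _
        · exact isHomogeneous_zero τ k e) (hξspan hwD)
    refine ⟨a, fun j hj => ha j (hele.trans_lt hj), ?_⟩
    simpa [hwy] using congrFun hsum y
  obtain ⟨i₁, hi₁, hne₁⟩ : ∃ i₁, d i₁ ≤ dE + dP ∧ i₁ ≠ i₀ := by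
    obtain ⟨a, ha, hsum⟩ := hkey (s z) (by simp [hs])
    by_contra! hcon
    refine mul_ne_zero hE0 (Finset.prod_ne_zero_iff.mpr fun i _ => hL0 i) (hsum.trans ?_)
    refine Finset.sum_eq_zero fun j _ => ?_
    by_cases hj : d j ≤ dE + dP
    · rw [hcon j hj, hξ₀y, mul_zero]
    · rw [ha j (not_le.mp hj), zero_mul]
  have hdvd (i : ι) (hi : c i z ≠ 0) :
      ξ i₁ y ∣ E * ∏ i' ∈ ({i' | c i' z ≠ 0} : Finset ι).erase i, L i' ^ m i' := by
    obtain ⟨a, ha, hsum⟩ := hkey i hi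
    rw [hsum]
    refine Finset.dvd_sum fun j _ => ?_
    by_cases hj : d j ≤ dE + dP
    · by_cases hj₀ : j = i₀
      · rw [hj₀, hξ₀y, mul_zero]
        exact dvd_zero _
      · rw [huniq hj hj₀ hi₁ hne₁]
        exact dvd_mul_left _ _
    · rw [ha j (not_le.mp hj), zero_mul]
      exact dvd_zero _
  refine ⟨ξ i₁, hξD i₁, hlow hi₁, ?_⟩
  have hfP : IsRelPrime (ξ i₁ y) P := by
    refine IsRelPrime.prod_right fun i hi => IsRelPrime.pow_right (IsRelPrime.symm ?_)
    refine (hirr i).isRelPrime_iff_not_dvd.mpr fun h => (hirr i).not_isUnit ?_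
    have hiz := (Finset.mem_filter.mp hi).2
    have h1 : IsRelPrime (L i)
        (E * ∏ i' ∈ ({i' | c i' z ≠ 0} : Finset ι).erase i, L i' ^ m i') := by
      refine IsRelPrime.mul_right (IsRelPrime.prod_right fun i' hi' => ?_)
        (IsRelPrime.prod_right fun i' hi' => ?_)
      · refine (hrel i i' fun h => hiz ?_).pow_right
        rw [h]
        exact (Finset.mem_filter.mp hi').2.1
      · exact (hrel i i' (Finset.ne_of_mem_erase hi').symm).pow_right
    exact h1 dvd_rfl (h.trans (hdvd i hiz))
  refine hfP.dvd_of_dvd_mul_right ((hdvd (s z) (by simp [hs])).trans (mul_dvd_mul_left _ ?_))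
  exact Finset.prod_dvd_prod_of_subset _ _ _ (Finset.erase_subset _ _)

end Multi

section LinearForms

variable {K : Type} [Field K] {ℓ : ℕ}

theorem linForm_add (a b : Fin ℓ → K) : linForm K (a + b) = linForm K a + linForm K b := by
  simp [linForm, add_mul, Finset.sum_add_distrib]

theorem linForm_smul (r : K) (a : Fin ℓ → K) : linForm K (r • a) = r • linForm K a := by
  simp [linForm, Finset.smul_sum, smul_eq_C_mul, mul_assoc]

/-- `linForm` as a linear map. -/
noncomputable def linFormMap (K : Type) [Field K] (ℓ : ℕ) :
    (Fin ℓ → K) →ₗ[K] MvPolynomial (Fin ℓ) K where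
  toFun := linForm K
  map_add' := linForm_add
  map_smul' := linForm_smul

theorem linFormMap_apply (a : Fin ℓ → K) : linFormMap K ℓ a = linForm K a := rfl

theorem linForm_single (j : Fin ℓ) : linForm K (Pi.single j 1) = X j := by
  simp [linForm, Pi.single_apply]

theorem linForm_eq_sum (a : Fin ℓ → K) : linForm K a = ∑ j, a j • X j := by
  simp [linForm, smul_eq_C_mul]

theorem linForm_isHomogeneous (a : Fin ℓ → K) : (linForm K a).IsHomogeneous 1 :=
  IsHomogeneous.sum _ _ _ fun j _ => isHomogeneous_C_mul_X (a j) j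

theorem linForm_injective : Function.Injective (linForm K (ℓ := ℓ)) := by
  intro a b h
  funext j
  have h1 := congrArg (coeff (Finsupp.single j 1)) h
  simpa [linForm, coeff_sum, coeff_C_mul, coeff_X, Finsupp.single_left_inj] using h1

theorem linForm_eq_zero_iff {a : Fin ℓ → K} : linForm K a = 0 ↔ a = 0 :=
  map_eq_zero_iff (linFormMap K ℓ) linForm_injective

theorem linForm_irreducible {a : Fin ℓ → K} (ha : a ≠ 0) : Irreducible (linForm K a) := by
  have h0 : linForm K a ≠ 0 := linForm_eq_zero_iff.not.mpr ha
  refine irreducible_of_totalDegree_eq_one ((linForm_isHomogeneous a).totalDegree h0)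
    fun r hr => IsUnit.mk0 r fun hr0 => h0 ?_
  ext m
  rw [coeff_zero]
  simpa [hr0] using hr m

theorem isRelPrime_linForm {a b : Fin ℓ → K} (ha : a ≠ 0) (hb : b ≠ 0) (hab : ∀ r : K, b ≠ r • a) :
    IsRelPrime (linForm K a) (linForm K b) := by
  refine (linForm_irreducible ha).isRelPrime_iff_not_dvd.mpr fun ⟨r, hr⟩ => ?_
  have hb0 : linForm K b ≠ 0 := linForm_eq_zero_iff.not.mpr hb
  have h1 := totalDegree_mul_of_isDomain (left_ne_zero_of_mul (hr ▸ hb0))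
    (right_ne_zero_of_mul (hr ▸ hb0))
  rw [← hr, (linForm_isHomogeneous b).totalDegree hb0,
    (linForm_isHomogeneous a).totalDegree (left_ne_zero_of_mul (hr ▸ hb0))] at h1
  have h2 := totalDegree_eq_zero_iff_eq_C.mp (show r.totalDegree = 0 by omega)
  refine hab (coeff 0 r) (linForm_injective ?_)
  rw [linForm_smul, smul_eq_C_mul, ← h2, mul_comm, hr]

theorem aeval_linForm (T : (Fin ℓ → K) →ₗ[K] MvPolynomial (Fin ℓ) K) (a : Fin ℓ → K) :
    aeval (fun j => T (Pi.single j 1)) (linForm K a) = T a := by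
  rw [LinearMap.pi_apply_eq_sum_univ T a, linForm_eq_sum, map_sum]
  refine Finset.sum_congr rfl fun j _ => ?_
  rw [map_smul, aeval_X]
  congr 2
  ext i
  simp [Pi.single_apply, eq_comm]

theorem mkDerivation_linForm (T : (Fin ℓ → K) →ₗ[K] MvPolynomial (Fin ℓ) K) (a : Fin ℓ → K) :
    mkDerivation K (fun j => T (Pi.single j 1)) (linForm K a) = T a := by
  rw [LinearMap.pi_apply_eq_sum_univ T a, linForm_eq_sum, map_sum]
  refine Finset.sum_congr rfl fun j _ => ?_
  rw [Derivation.map_smul, mkDerivation_X]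
  congr 2
  ext i
  simp [Pi.single_apply, eq_comm]

theorem derivation_linForm (b : Module.Basis (Fin ℓ) K (Fin ℓ → K))
    (θ : Derivation K (MvPolynomial (Fin ℓ) K) (MvPolynomial (Fin ℓ) K)) (a : Fin ℓ → K) :
    θ (linForm K a) = ∑ j, C (b.repr a j) * θ (linForm K (b j)) := by
  have h1 : (θ : _ →ₗ[K] MvPolynomial (Fin ℓ) K) ∘ₗ linFormMap K ℓ =
      b.constr K fun j => θ (linForm K (b j)) := b.ext fun j => by
    rw [b.constr_basis]; rfl
  have h2 := LinearMap.congr_fun h1 a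
  rw [Module.Basis.constr_apply_fintype] at h2
  simpa [linFormMap_apply, smul_eq_C_mul] using h2

/-- A derivation of the polynomial ring is determined by its values on a basis of the
linear forms. -/
noncomputable def derivationEquiv (b : Module.Basis (Fin ℓ) K (Fin ℓ → K)) :
    Derivation K (MvPolynomial (Fin ℓ) K) (MvPolynomial (Fin ℓ) K) ≃ₗ[MvPolynomial (Fin ℓ) K]
      (Fin ℓ → MvPolynomial (Fin ℓ) K) where
  toFun θ j := θ (linForm K (b j))
  map_add' _ _ := rfl
  map_smul' _ _ := rfl
  invFun w := mkDerivation K fun j => b.constr K w (Pi.single j 1)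
  left_inv θ := derivation_ext fun j => by
    rw [← linForm_single, mkDerivation_linForm, derivation_linForm b, b.constr_apply_fintype K]
    simp [smul_eq_C_mul]
  right_inv w := by
    funext j
    exact (mkDerivation_linForm (b.constr K w) (b j)).trans (b.constr_basis K w j)

theorem mem_map_derivationEquiv (b : Module.Basis (Fin ℓ) K (Fin ℓ → K)) {ι : Type*}
    (A : ι → Fin ℓ → K) (m : ι → ℕ) (w : Fin ℓ → MvPolynomial (Fin ℓ) K) :
    w ∈ (derivModuleMulti K A m).map (derivationEquiv b).toLinearMap ↔
      ∀ i, linForm K (A i) ^ m i ∣ ∑ j, C (b.repr (A i) j) * w j := by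
  obtain ⟨θ, rfl⟩ := (derivationEquiv b).surjective w
  have h1 : derivationEquiv b θ ∈ (derivModuleMulti K A m).map (derivationEquiv b).toLinearMap ↔
      θ ∈ derivModuleMulti K A m := by
    rw [Submodule.mem_map]
    exact ⟨fun ⟨η, hη, h⟩ => (derivationEquiv b).injective h ▸ hη, fun h => ⟨θ, h, rfl⟩⟩
  rw [h1]
  refine forall_congr' fun i => ?_
  rw [Ideal.mem_span_singleton, derivation_linForm b]
  rfl

open Classical in
theorem not_dvd_prod {ι : Type*} [Fintype ι] {A : ι → Fin ℓ → K} (hA : IsCentral K A)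
    (b : Module.Basis (Fin ℓ) K (Fin ℓ → K)) {s : Fin ℓ → ι} (hs : ∀ j, A (s j) = b j)
    {q : ι} {p y z : Fin ℓ} (hpy : p ≠ y) (hpz : p ≠ z) (hyz : y ≠ z)
    (hqp : b.repr (A q) p ≠ 0) (hqy : b.repr (A q) y ≠ 0)
    {m : ι → ℕ} (hmz : m (s z) = 2) (hmq : m q = 2)
    (hm : ∀ i, b.repr (A i) z = 0 → b.repr (A i) y ≠ 0 → i ≠ s y → m i = 1)
    {w : Fin ℓ → MvPolynomial (Fin ℓ) K}
    (hw : ∀ i, linForm K (A i) ^ m i ∣ ∑ j, C (b.repr (A i) j) * w j)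
    (hw0 : ∀ j, j ≠ y → j ≠ z → w j = 0) :
    ¬ w y ∣ ∏ i with b.repr (A i) z = 0 ∧ b.repr (A i) y ≠ 0, linForm K (A i) ^ m i := by
  rintro ⟨h, hE⟩
  set v : Fin ℓ → K := A q - b.repr (A q) z • b z with hv
  -- The projection with kernel spanned by `A q` and `b z`.
  let R : (Fin ℓ → K) →ₗ[K] Fin ℓ → K := LinearMap.id -
    (b.coord y).smulRight ((b.repr (A q) y)⁻¹ • v) - (b.coord z).smulRight (b z)
  have hR (a : Fin ℓ → K) :
      R a = a - b.repr a y • (b.repr (A q) y)⁻¹ • v - b.repr a z • b z := rfl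
  let ψ : MvPolynomial (Fin ℓ) K →ₐ[K] MvPolynomial (Fin ℓ) K :=
    aeval fun j => (linFormMap K ℓ ∘ₗ R) (Pi.single j 1)
  have hψ (a : Fin ℓ → K) : ψ (linForm K a) = linForm K (R a) := aeval_linForm _ a
  let δ : Derivation K (MvPolynomial (Fin ℓ) K) (MvPolynomial (Fin ℓ) K) :=
    mkDerivation K fun j => (Algebra.linearMap K (MvPolynomial (Fin ℓ) K) ∘ₗ b.coord y)
      (Pi.single j 1)
  have hδ (a : Fin ℓ → K) : δ (linForm K a) = C (b.repr a y) := mkDerivation_linForm _ a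
  have hsq {f g : MvPolynomial (Fin ℓ) K} (hf : ψ f = 0) (hfg : f ^ 2 ∣ g) :
      ψ g = 0 ∧ ψ (δ g) = 0 := by
    obtain ⟨r, rfl⟩ := hfg
    constructor
    · simp [hf]
    · simp [Derivation.leibniz, pow_two, hf]
  have hψz : ψ (linForm K (A (s z))) = 0 := by
    rw [hψ, linForm_eq_zero_iff, hR, hs]
    simp [hyz]
  have hψq : ψ (linForm K (A q)) = 0 := by
    rw [hψ, linForm_eq_zero_iff, hR, smul_inv_smul₀ hqy, hv]
    abel
  have h1 := hsq hψz (g := w z) (by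
    have := hw (s z)
    simpa [hmz, hs, Finsupp.single_apply, ite_mul] using this)
  have h2 := hsq hψq (g := C (b.repr (A q) y) * w y + C (b.repr (A q) z) * w z) (by
    have := hw q
    rwa [hmq, sum_eq_add_of_eq_zero hyz _ hw0] at this)
  have h3 : ψ (w y) = 0 := by
    have := h2.1
    rw [map_add, map_mul, map_mul, h1.1, mul_zero, add_zero, mul_eq_zero] at this
    refine this.resolve_left ?_
    simpa [ψ] using hqy
  have h4 : ψ (δ (w y)) = 0 := by
    have := h2.2
    rw [← smul_eq_C_mul, ← smul_eq_C_mul, map_add, Derivation.map_smul, Derivation.map_smul,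
      map_add, map_smul, map_smul, h1.2, smul_zero, add_zero] at this
    exact (smul_eq_zero.mp this).resolve_left hqy
  have hprop {i : ι} (hi : b.repr (A i) z = 0) (h : ψ (linForm K (A i)) = 0) :
      A i = (b.repr (A i) y * (b.repr (A q) y)⁻¹) • v := by
    rw [hψ, linForm_eq_zero_iff, hR, hi, zero_smul, sub_zero, sub_eq_zero] at h
    rw [mul_smul]
    exact h
  have hexists {F : Finset ι} (hF : ψ (∏ i ∈ F, linForm K (A i) ^ m i) = 0) :
      ∃ i ∈ F, ψ (linForm K (A i)) = 0 := by
    rw [map_prod, Finset.prod_eq_zero_iff] at hF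
    obtain ⟨i, hi, h⟩ := hF
    rw [map_pow] at h
    exact ⟨i, hi, eq_zero_of_pow_eq_zero h⟩
  obtain ⟨i, hi, hψi⟩ := hexists (by rw [hE, map_mul, h3, zero_mul])
  have hi' := (Finset.mem_filter.mp hi).2
  have hiy : i ≠ s y := by
    rintro rfl
    have h5 := congrArg (fun a => b.repr a p) (hprop hi'.1 hψi)
    simp [hs, hv, hpy.symm, hpz.symm, hqp, hqy] at h5
  have h6 : ψ (δ (w y * h)) = 0 := by
    simp [Derivation.leibniz, h3, h4]
  rw [← hE, ← Finset.mul_prod_erase _ _ hi, hm i hi'.1 hi'.2 hiy, pow_one, Derivation.leibniz,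
    hδ, map_add, smul_eq_mul, smul_eq_mul, map_mul, hψi, zero_mul, zero_add, map_mul,
    mul_eq_zero] at h6
  obtain ⟨i₁, hi₁, hψi₁⟩ := hexists (h6.resolve_right (by simpa [ψ] using hi'.2))
  have hi₁' := (Finset.mem_filter.mp (Finset.mem_of_mem_erase hi₁)).2
  refine hA.2 i₁ i (Finset.ne_of_mem_erase hi₁) (b.repr (A i₁) y * (b.repr (A i) y)⁻¹) ?_
  have h7 := hi'.2
  calc A i₁ = _ := hprop hi₁'.1 hψi₁
    _ = (b.repr (A i₁) y * (b.repr (A i) y)⁻¹) •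
        ((b.repr (A i) y * (b.repr (A q) y)⁻¹) • v) := by
      rw [smul_smul]
      congr 1
      field_simp
    _ = _ := by rw [← hprop hi'.1 hψi]

end LinearForms

section Free

variable {K : Type} [Field K] {ℓ : ℕ}

open Classical in
/-- If every multiarrangement on `A` is free, then a hyperplane of `A` involves at most two
members of any basis consisting of hyperplanes of `A`. -/
theorem repr_eq_zero_of_forall_free {ι : Type*} [Fintype ι] {A : ι → Fin ℓ → K}
    (hA : IsCentral K A)
    (hfree : ∀ m : ι → ℕ, (∀ i, 1 ≤ m i) →
      Module.Free (MvPolynomial (Fin ℓ) K) (derivModuleMulti K A m))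
    (b : Module.Basis (Fin ℓ) K (Fin ℓ → K)) {s : Fin ℓ → ι} (hs : ∀ j, A (s j) = b j)
    {q : ι} {p y z : Fin ℓ} (hpy : p ≠ y) (hpz : p ≠ z) (hyz : y ≠ z)
    (hqp : b.repr (A q) p ≠ 0) (hqy : b.repr (A q) y ≠ 0) : b.repr (A q) z = 0 := by
  by_contra hqz
  have hrs (j k : Fin ℓ) : b.repr (A (s j)) k = if j = k then 1 else 0 := by
    rw [hs, b.repr_self, Finsupp.single_apply]
  have hsinj : Function.Injective s := fun j k h => by
    by_contra hjk
    have h1 := hrs j k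
    rw [h, hrs, if_pos rfl, if_neg hjk] at h1
    exact one_ne_zero h1
  have hsq (j : Fin ℓ) : s j ≠ q := by
    rintro rfl
    simp only [hrs, ne_eq, ite_eq_right_iff, one_ne_zero, imp_false, not_not] at hqp hqy
    exact hpy (hqp.symm.trans hqy)
  let M := 2 * Fintype.card ι + 1
  let m : ι → ℕ := fun i => if i = s z ∨ i = q then 2 else if i = s y then M else
    if i ∈ Set.range s then Fintype.card ι * M + M else 1
  have hM : 1 ≤ M := by omega
  have hcard : 1 ≤ Fintype.card ι := Fintype.card_pos_iff.mpr ⟨q⟩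
  have hmz : m (s z) = 2 := if_pos (Or.inl rfl)
  have hmq : m q = 2 := if_pos (Or.inr rfl)
  have hmy : m (s y) = M := by simp [m, hsinj.eq_iff, hyz, hsq]
  have hmj (j : Fin ℓ) (hjy : j ≠ y) (hjz : j ≠ z) : m (s j) = Fintype.card ι * M + M := by
    simp [m, hsinj.eq_iff, hjy, hjz, hsq]
  have hmi (i : ι) (hiq : i ≠ q) (hi : i ∉ Set.range s) : m i = 1 := by
    have h1 (j : Fin ℓ) : i ≠ s j := fun h => hi ⟨j, h.symm⟩
    simp only [m, h1, hiq, hi, or_self, if_false]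
  have hm1 (i : ι) : 1 ≤ m i := by
    dsimp only [m]
    split_ifs <;> omega
  have hzle (i : ι) (hi : b.repr (A i) z ≠ 0) : m i ≤ 2 := by
    by_cases hiq : i = q
    · rw [hiq, hmq]
    by_cases his : i ∈ Set.range s
    · obtain ⟨j, rfl⟩ := his
      obtain rfl : j = z := by simpa [hrs] using hi
      rw [hmz]
    · rw [hmi i hiq his]
      exact one_le_two
  have hyeq (i : ι) (hiz : b.repr (A i) z = 0) (hi : b.repr (A i) y ≠ 0) (hiy : i ≠ s y) :
      m i = 1 := by
    refine hmi i (fun h => hqz (h ▸ hiz)) ?_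
    rintro ⟨j, rfl⟩
    obtain rfl : j = y := by simpa [hrs] using hi
    exact hiy rfl
  have hyle (i : ι) (hi : b.repr (A i) z = 0 ∧ b.repr (A i) y ≠ 0) : m i ≤ M := by
    by_cases hiy : i = s y
    · rw [hiy, hmy]
    · rw [hyeq i hi.1 hi.2 hiy]
      exact hM
  have hsumz : ∑ i with b.repr (A i) z ≠ 0, m i < M := by
    refine ((Finset.sum_le_card_nsmul _ m 2 fun i hi =>
      hzle i (Finset.mem_filter.mp hi).2).trans ?_).trans_lt
      (show Fintype.card ι * 2 < M by omega)
    exact Nat.mul_le_mul_right 2 (Finset.card_le_univ _)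
  have hsumy : ∑ i with b.repr (A i) z = 0 ∧ b.repr (A i) y ≠ 0, m i ≤ Fintype.card ι * M := by
    refine (Finset.sum_le_card_nsmul _ m M fun i hi => hyle i (Finset.mem_filter.mp hi).2).trans ?_
    exact Nat.mul_le_mul_right M (Finset.card_le_univ _)
  have := hfree m hm1
  have : Module.Free (MvPolynomial (Fin ℓ) K)
      ((derivModuleMulti K A m).map (derivationEquiv b).toLinearMap) :=
    Module.Free.of_equiv ((derivationEquiv b).submoduleMap _)
  obtain ⟨w, hwD, hw0, hdvd⟩ := exists_dvd_prod_of_free (fun i => linForm K (A i))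
    (fun i => b.repr (A i)) m _ (mem_map_derivationEquiv b A m)
    (fun i => linForm_isHomogeneous (A i)) (fun i => linForm_irreducible (hA.1 i))
    (fun i i' h => isRelPrime_linForm (hA.1 i) (hA.1 i') (hA.2 i' i h.symm)) s
    (fun j => by rw [hs, b.repr_self, Finsupp.single_eq_pi_single]) hyz
    (by rw [hmy]; exact hsumz)
    (fun j hjy hjz => by rw [hmj j hjy hjz]; omega)
  exact not_dvd_prod hA b hs hpy hpz hyz hqp hqy hmz hmq hyeq
    ((mem_map_derivationEquiv b A m w).mp hwD) hw0 hdvd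

end Free

section Decomposition

variable {K : Type} [Field K] {ℓ : ℕ} {ι : Type*} {A : ι → Fin ℓ → K}

theorem linFunc_apply (a x : Fin ℓ → K) : linFunc K a x = ∑ j, a j * x j := by
  simp [linFunc]

theorem exists_dual_basis (b : Module.Basis (Fin ℓ) K (Fin ℓ → K)) :
    ∃ e : Module.Basis (Fin ℓ) K (Fin ℓ → K), ∀ a j, linFunc K a (e j) = b.repr a j := by
  let e : Fin ℓ → Fin ℓ → K := fun j i => b.coord j (Pi.single i 1)
  have he (a : Fin ℓ → K) (j : Fin ℓ) : linFunc K a (e j) = b.repr a j := by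
    rw [linFunc_apply, ← b.coord_apply, LinearMap.pi_apply_eq_sum_univ (b.coord j) a]
    refine Finset.sum_congr rfl fun i _ => ?_
    refine congrArg (fun v => a i * b.coord j v) ?_
    ext i'
    simp [Pi.single_apply, eq_comm]
  have hli : LinearIndependent K e := Fintype.linearIndependent_iff.mpr fun g hg k => by
    have h1 := congrArg (linFunc K (b k)) hg
    simpa [he, Finsupp.single_apply] using h1
  cases isEmpty_or_nonempty (Fin ℓ) with
  | inl h => exact ⟨b, fun _ j => isEmptyElim j⟩
  | inr h =>
    refine ⟨basisOfLinearIndependentOfCardEqFinrank hli (by simp), fun a j => ?_⟩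
    rw [coe_basisOfLinearIndependentOfCardEqFinrank, he]

theorem exists_basis_of_isEssential (hess : IsEssential K A) :
    ∃ (b : Module.Basis (Fin ℓ) K (Fin ℓ → K)) (s : Fin ℓ → ι), ∀ j, A (s j) = b j := by
  obtain ⟨f, hfA, hspan, hli⟩ := Submodule.exists_fun_fin_finrank_span_eq K (Set.range A)
  have hcard : Module.finrank K (Submodule.span K (Set.range A)) = ℓ := by
    rw [show Submodule.span K (Set.range A) = ⊤ from hess, finrank_top, Module.finrank_fin_fun]
  let b := (Module.Basis.mk hli (hspan.trans hess).ge).reindex (finCongr hcard)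
  choose s hs using fun j => hfA ((finCongr hcard).symm j)
  exact ⟨b, s, fun j => by rw [hs]; simp [b]⟩

/-- Suppose that no hyperplane of `A` involves three members of a basis consisting of hyperplanes
of `A`. Then two hyperplanes of `A` involving a common basis member involve at most two members
in total: otherwise exchanging the common member produces a forbidden basis. -/
theorem eq_zero_of_common_coord
    (h3 : ∀ (b : Module.Basis (Fin ℓ) K (Fin ℓ → K)) (s : Fin ℓ → ι), (∀ j, A (s j) = b j) →
      ∀ (q : ι) (p y z : Fin ℓ), p ≠ y → p ≠ z → y ≠ z → b.repr (A q) p ≠ 0 →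
        b.repr (A q) y ≠ 0 → b.repr (A q) z = 0)
    (b : Module.Basis (Fin ℓ) K (Fin ℓ → K)) {s : Fin ℓ → ι} (hs : ∀ j, A (s j) = b j)
    {i i' : ι} {j k l : Fin ℓ} (hjk : j ≠ k) (hjl : j ≠ l) (hkl : k ≠ l)
    (hij : b.repr (A i) j ≠ 0) (hik : b.repr (A i) k ≠ 0) (hik' : b.repr (A i') k ≠ 0) :
    b.repr (A i') l = 0 := by
  by_contra hil'
  have hsum {i : ι} {j k : Fin ℓ} (hjk : j ≠ k) (hj : b.repr (A i) j ≠ 0)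
      (hk : b.repr (A i) k ≠ 0) : b.repr (A i) j • b j + b.repr (A i) k • b k = A i := by
    rw [← Fintype.sum_eq_add (f := fun m => b.repr (A i) m • b m) j k hjk fun m hm => by
      rw [h3 b s hs i j k m hjk hm.1.symm hm.2.symm hj hk, zero_smul], b.sum_repr]
  have hi := hsum hjk hij hik
  have hi' := hsum hkl hik' hil'
  set α := b.repr (A i) j
  set β := b.repr (A i) k
  set γ := b.repr (A i') k
  set ε := b.repr (A i') l
  let v : Fin ℓ → Fin ℓ → K := fun m => A (Function.update s k i' m)
  have hvk : v k = A i' := by simp [v]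
  have hv {m : Fin ℓ} (hm : m ≠ k) : v m = b m := by simp [v, hm, hs]
  have hbk : b k = γ⁻¹ • v k - (γ⁻¹ * ε) • v l := by
    rw [hvk, hv hkl.symm, ← hi', smul_add, smul_smul, smul_smul, inv_mul_cancel₀ hik', one_smul,
      add_sub_cancel_right]
  have hspan : ⊤ ≤ Submodule.span K (Set.range v) := by
    have hmem (m : Fin ℓ) : v m ∈ Submodule.span K (Set.range v) :=
      Submodule.subset_span (Set.mem_range_self m)
    rw [← b.span_eq, Submodule.span_le]
    rintro _ ⟨m, rfl⟩
    by_cases hm : m = k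
    · rw [hm, hbk]
      exact sub_mem (Submodule.smul_mem _ _ (hmem k)) (Submodule.smul_mem _ _ (hmem l))
    · rw [← hv hm]
      exact hmem m
  let b' := basisOfTopLeSpanOfCardEqFinrank v hspan (by simp)
  have hb' : ⇑b' = v := coe_basisOfTopLeSpanOfCardEqFinrank v hspan (by simp)
  have hAi : A i = α • b' j + (β * γ⁻¹) • b' k - (β * (γ⁻¹ * ε)) • b' l := by
    rw [← hi, hbk, hb', hv hjk, smul_sub, smul_smul, smul_smul, add_sub_assoc]
  have h1 := h3 b' (Function.update s k i') (fun m => by rw [hb']) i j k l hjk hjl hkl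
  rw [hAi] at h1
  simp [hjk, hjl, hkl, hjk.symm, hjl.symm, hkl.symm, hij, hik, hik',
    hil'] at h1

/-- If a basis of the space of linear forms is partitioned into blocks of size at most two such
that each member of `A` only involves basis members of a single block, then `A` is a product of
arrangements of rank at most two. -/
theorem exists_decomposition (hA : ∀ i, A i ≠ 0) (b : Module.Basis (Fin ℓ) K (Fin ℓ → K)) {s : ℕ}
    (π : Fin ℓ → Fin s) (hcard : ∀ k, (Finset.univ.filter fun j => π j = k).card ≤ 2)
    (hπ : ∀ i j k, b.repr (A i) j ≠ 0 → b.repr (A i) k ≠ 0 → π j = π k) :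
    ∃ V : Fin s → Submodule K (Fin ℓ → K),
      iSupIndep V ∧ (⨆ j, V j) = ⊤ ∧ (∀ j, Module.finrank K (V j) ≤ 2) ∧
      ∀ i, ∃ (j : Fin s) (Hj : Submodule K (Fin ℓ → K)), Hj ≤ V j ∧
        Module.finrank K Hj + 1 = Module.finrank K (V j) ∧
        hyperplane K (A i) = Hj ⊔ ⨆ k ∈ {k | k ≠ j}, V k := by
  classical
  obtain ⟨e, he⟩ := exists_dual_basis b
  let V : Fin s → Submodule K (Fin ℓ → K) := fun k => Submodule.span K (e '' {j | π j = k})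
  have hmem (j : Fin ℓ) : e j ∈ V (π j) := Submodule.subset_span ⟨j, rfl, rfl⟩
  have htop : ⨆ k, V k = ⊤ := by
    rw [eq_top_iff, ← e.span_eq, Submodule.span_le]
    rintro _ ⟨j, rfl⟩
    exact Submodule.mem_iSup_of_mem (π j) (hmem j)
  refine ⟨V, fun k => ?_, htop, fun k => ?_, fun i => ?_⟩
  · have h1 : ⨆ (k') (_ : k' ≠ k), V k' ≤ Submodule.span K (e '' {j | π j ≠ k}) :=
      iSup₂_le fun k' hk' => Submodule.span_mono <| Set.image_mono fun j hj => by
        rw [Set.mem_ofPred_eq, show π j = k' from hj]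
        exact hk'
    refine (e.linearIndependent.disjoint_span_image ?_).mono_right h1
    exact Set.disjoint_left.mpr fun j hj hj' => hj' hj
  · have h1 := (finrank_span_finset_le_card (R := K)
      ((Finset.univ.filter fun j => π j = k).image e)).trans Finset.card_image_le
    rw [Finset.coe_image, Finset.coe_filter_univ] at h1
    exact h1.trans (hcard k)
  · obtain ⟨j, hj⟩ : ∃ j, b.repr (A i) j ≠ 0 := by
      by_contra! h
      exact hA i (b.ext_elem fun j => by rw [h, map_zero, Finsupp.zero_apply])
    have hW : ⨆ k ∈ {k | k ≠ π j}, V k ≤ hyperplane K (A i) :=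
      iSup₂_le fun k hk => Submodule.span_le.mpr <| by
        rintro _ ⟨j', hj', rfl⟩
        rw [hyperplane, SetLike.mem_coe, LinearMap.mem_ker, he]
        by_contra h
        exact hk (hj'.symm.trans (hπ i j' j h hj))
    have hV : V (π j) ⊔ ⨆ k ∈ {k | k ≠ π j}, V k = ⊤ := by
      rw [eq_top_iff, ← htop]
      refine iSup_le fun k => ?_
      by_cases hk : k = π j
      · exact hk ▸ le_sup_left
      · exact le_sup_of_le_right (le_iSup₂_of_le k hk le_rfl)
    refine ⟨π j, V (π j) ⊓ hyperplane K (A i), inf_le_left, ?_, ?_⟩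
    · have h1 : (linFunc K (A i)).domRestrict (V (π j)) ≠ 0 := fun h => hj <| by
        rw [← he]
        exact LinearMap.congr_fun h ⟨e j, hmem j⟩
      have h2 := Module.Dual.finrank_ker_add_one_of_ne_zero h1
      rwa [LinearMap.ker_domRestrict, ← Submodule.finrank_map_subtype_eq,
        Submodule.map_comap_subtype] at h2
    · rw [inf_comm, inf_sup_assoc_of_le _ hW, hV, inf_top_eq]

end Decomposition

end Arr

/-- **Abe–Terao–Yoshinaga theorem.**  If the multiarrangement `(A,m)` is free for every
choice of multiplicities `m`, then `A` decomposes as a product of arrangements of rank at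
most 2: there is a direct-sum decomposition `K^ℓ = V_1 ⊕ ⋯ ⊕ V_s` with `dim V_j ≤ 2`
such that every hyperplane of `A` is of the form
`V_1 ⊕ ⋯ ⊕ V_{j−1} ⊕ H_j ⊕ V_{j+1} ⊕ ⋯ ⊕ V_s` for some `j` and some hyperplane
`H_j ⊂ V_j`. -/
theorem abe_terao_yoshinaga (K : Type) [Field K] [CharZero K] (ℓ n : ℕ)
    (A : Fin n → Fin ℓ → K) (hA : IsCentral K A) (hess : IsEssential K A)
    (hfree : ∀ m : Fin n → ℕ, (∀ i, 1 ≤ m i) →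
      Module.Free (MvPolynomial (Fin ℓ) K) (derivModuleMulti K A m)) :
    ∃ (s : ℕ) (V : Fin s → Submodule K (Fin ℓ → K)),
      iSupIndep V ∧ (⨆ j, V j) = ⊤ ∧ (∀ j, Module.finrank K (V j) ≤ 2) ∧
      ∀ i, ∃ (j : Fin s) (Hj : Submodule K (Fin ℓ → K)), Hj ≤ V j ∧
        Module.finrank K Hj + 1 = Module.finrank K (V j) ∧
        hyperplane K (A i) = Hj ⊔ ⨆ k ∈ {k | k ≠ j}, V k := by
  obtain ⟨b, s, hs⟩ := exists_basis_of_isEssential hess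
  have hcommon {i i' : Fin n} {j k l : Fin ℓ} (hjk : j ≠ k) (hjl : j ≠ l) (hkl : k ≠ l) :=
    eq_zero_of_common_coord (A := A) (fun b s hs q p y z hpy hpz hyz hp hy =>
      repr_eq_zero_of_forall_free hA hfree b hs hpy hpz hyz hp hy) b hs (i := i) (i' := i')
      hjk hjl hkl
  let r : Setoid (Fin ℓ) :=
    { r := fun j k => j = k ∨ ∃ i, b.repr (A i) j ≠ 0 ∧ b.repr (A i) k ≠ 0
      iseqv :=
        { refl := fun j => Or.inl rfl
          symm := by
            rintro j k (h | ⟨i, h, h'⟩)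
            · exact Or.inl h.symm
            · exact Or.inr ⟨i, h', h⟩
          trans := by
            rintro j k l (rfl | ⟨i, hij, hik⟩) (rfl | ⟨i', hik', hil'⟩)
            · exact Or.inl rfl
            · exact Or.inr ⟨i', hik', hil'⟩
            · exact Or.inr ⟨i, hij, hik⟩
            · by_cases hjk : j = k
              · exact Or.inr ⟨i', hjk ▸ hik', hil'⟩
              by_cases hkl : k = l
              · exact Or.inr ⟨i, hij, hkl ▸ hik⟩
              by_cases hjl : j = l
              · exact Or.inl hjl
              exact absurd (hcommon hjk hjl hkl hij hik hik') hil' } }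
  have hπ (j k : Fin ℓ) : (Quotient.mk r j).out = (Quotient.mk r k).out ↔ r j k :=
    Quotient.out_inj.trans Quotient.eq
  refine ⟨ℓ, exists_decomposition hA.1 b (fun j => (Quotient.mk r j).out) (fun k => ?_)
    fun i j k hj hk => (hπ j k).mpr (Or.inr ⟨i, hj, hk⟩)⟩
  by_contra! hcard
  obtain ⟨x, y, z, hx, hy, hz, hxy, hxz, hyz⟩ := Finset.two_lt_card_iff.mp hcard
  rw [Finset.mem_filter_univ] at hx hy hz
  obtain ⟨i, hix, hiy⟩ := ((hπ x y).mp (hx.trans hy.symm)).resolve_left hxy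
  obtain ⟨i', hiy', hiz'⟩ := ((hπ y z).mp (hy.trans hz.symm)).resolve_left hyz
  exact hiz' (hcommon hxy hxz hyz hix hiy hiy')
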